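/- Let q : (0,∞) → ℂ be measurable with ∫_0^∞ (1+x)|q(x)| dx < ∞ and ‖q‖ ≥ 1. Set φ(r) = (2/π)·∫_0^r (sin t)/t dt and C₀ = (4e² + 1 + e⁴)/4. Then limsup_{s→∞} (1/π)·∫_0^s log|ψ(t)·ψ(−t)| dt ≤ (2/π)·(‖q‖₁ + ‖q‖·(C₀ + log‖q‖)) + (1/2)·∫_0^∞ Re q(x)·(1 − φ(2x·‖q‖)) dx. -/

import Mathlib

open MeasureTheory Complex Filter Set

/-- The kernel `G(t,k) = (sin(kt)/k)·e^{ikt}` for `k ≠ 0`, with `G(t,0) = t`. -/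
noncomputable def G (t : ℝ) (k : ℂ) : ℂ :=
  if k = 0 then (t : ℂ) else Complex.sin (k * t) / k * Complex.exp (Complex.I * k * t)

/-- The previous node `t_{j-1}` of the simplex `x = t₀ < t₁ < ⋯ < t_n`. -/
noncomputable def prevNode (x : ℝ) {n : ℕ} (t : Fin n → ℝ) (j : Fin n) : ℝ :=
  if (j : ℕ) = 0 then x
  else t ⟨(j : ℕ) - 1, Nat.lt_of_le_of_lt (Nat.sub_le _ _) j.isLt⟩

/-- The iterated simplex integral
`y_n(x,k) = ∫_{x = t₀ < t₁ < ⋯ < t_n} ∏_{j=1}^n G(t_j − t_{j−1}, k)·q(t_j) dt₁⋯dt_n`. -/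
noncomputable def ysimp (q : ℝ → ℂ) (n : ℕ) (x : ℝ) (k : ℂ) : ℂ :=
  ∫ t : Fin n → ℝ in {t | StrictMono t ∧ ∀ i, x < t i},
    ∏ j, G (t j - prevNode x t j) k * q (t j)

/-- The Jost function `ψ(k) = 1 + ∑_{n ≥ 1} y_n(0,k)`. -/
noncomputable def jost (q : ℝ → ℂ) (k : ℂ) : ℂ :=
  1 + ∑' n : ℕ, ysimp q (n + 1) 0 k

/-- The function `φ(r) = (2/π)∫_0^r (sin t)/t dt`. -/
noncomputable def phiSine (r : ℝ) : ℝ := (2 / Real.pi) * ∫ t in (0:ℝ)..r, Real.sin t / t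

lemma measSet_strictMono (n : ℕ) : MeasurableSet {t : Fin n → ℝ | StrictMono t} := by
  have : {t : Fin n → ℝ | StrictMono t} = ⋂ i : Fin n, ⋂ j : Fin n, {t | i < j → t i < t j} := by
    ext t; simp only [mem_ofPred_eq, mem_iInter]
    exact ⟨fun h i j hij => h hij, fun h i j hij => h i j hij⟩
  rw [this]
  refine MeasurableSet.iInter fun i => MeasurableSet.iInter fun j => ?_
  by_cases hij : i < j
  · simp only [hij, true_imp_iff]
    exact measurableSet_lt (measurable_pi_apply i) (measurable_pi_apply j)
  · simp [hij]

lemma comp_perm_eq (n : ℕ) (σ : Equiv.Perm (Fin n)) : (fun t : Fin n → ℝ => t ∘ σ) =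
    MeasurableEquiv.piCongrLeft (fun _ : Fin n => ℝ) σ.symm := by
  funext t i
  rw [MeasurableEquiv.coe_piCongrLeft, Equiv.piCongrLeft_apply]
  simp

lemma simplex_bound (n : ℕ) (f : ℝ → ℝ) (hf : Integrable f) (h0 : ∀ x, 0 ≤ f x) :
    ∫ t : Fin n → ℝ in {t | StrictMono t}, ∏ i, f (t i) ≤ (∫ x, f x) ^ n / n.factorial := by
  set F : (Fin n → ℝ) → ℝ := fun t => ∏ i, f (t i) with hF
  have hFi : Integrable F := Integrable.fintype_prod (f := fun _ => f) (fun _ => hf)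
  let S : Equiv.Perm (Fin n) → Set (Fin n → ℝ) := fun σ => {t | StrictMono (t ∘ σ)}
  have hmp : ∀ σ : Equiv.Perm (Fin n), MeasurePreserving (fun t : Fin n → ℝ => t ∘ σ) := by
    intro σ
    rw [comp_perm_eq]
    exact volume_measurePreserving_piCongrLeft (fun _ : Fin n => ℝ) σ.symm
  have hS : ∀ σ, MeasurableSet (S σ) := fun σ => (hmp σ).measurable (measSet_strictMono n)
  have heq : ∀ σ, ∫ t in S σ, F t = ∫ t in {t | StrictMono t}, F t := by
    intro σ
    have he : MeasurableEmbedding (fun t : Fin n → ℝ => t ∘ σ) := by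
      rw [comp_perm_eq]
      exact (MeasurableEquiv.piCongrLeft (fun _ : Fin n => ℝ) σ.symm).measurableEmbedding
    rw [← (hmp σ).setIntegral_preimage_emb he F {t | StrictMono t}]
    refine setIntegral_congr_fun (hS σ) fun t _ => ?_
    simp only [hF, Function.comp]
    exact (Equiv.prod_comp σ (fun i => f (t i))).symm
  have hdisj : Pairwise (Function.onFun Disjoint S) := by
    intro σ τ hne
    rw [Function.onFun, Set.disjoint_left]
    intro t h1 h2
    apply hne
    have h1' : StrictMono (t ∘ σ) := h1
    have h2' : StrictMono (t ∘ τ) := h2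
    have h3 := (StrictMono.range_inj h1' h2').1 (by
      rw [EquivLike.range_comp, EquivLike.range_comp])
    have hinj : Function.Injective t := by
      have := h1'.injective
      rwa [EquivLike.injective_comp] at this
    ext i
    exact congrArg _ (hinj (congrFun h3 i))
  have hsum : (n.factorial : ℝ) * ∫ t in {t | StrictMono t}, F t ≤ (∫ x, f x) ^ n := by
    have h1 := integral_iUnion_fintype hS hdisj (fun σ => hFi.integrableOn (s := S σ))
    simp only [heq, Finset.sum_const, Finset.card_univ, Fintype.card_perm, Fintype.card_fin,
      nsmul_eq_mul] at h1
    rw [← h1]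
    have h2 : ∫ t, F t = (∫ x, f x) ^ n := by
      have := integral_fintype_prod_volume_eq_pow (ι := Fin n) f
      simpa [hF] using this
    rw [← h2]
    exact setIntegral_le_integral hFi (Eventually.of_forall fun t => Finset.prod_nonneg fun i _ => h0 _)
  rw [le_div_iff₀ (by positivity)]
  linarith

lemma ysimp_bound (q : ℝ → ℂ) (k : ℂ) (f : ℝ → ℝ) (hf : IntegrableOn f (Ioi 0))
    (hb : ∀ a b, 0 ≤ a → a < b → ‖G (b - a) k * q b‖ ≤ f b) (n : ℕ) :
    ‖ysimp q n 0 k‖ ≤ (∫ x in Ioi (0:ℝ), f x) ^ n / n.factorial := by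
  have hf0 : ∀ x, 0 < x → 0 ≤ f x := fun x hx => (norm_nonneg _).trans (hb 0 x le_rfl hx)
  set g : ℝ → ℝ := (Ioi (0:ℝ)).indicator f with hg
  have hgi : Integrable g := (integrable_indicator_iff measurableSet_Ioi).2 hf
  have hg0 : ∀ x, 0 ≤ g x := fun x => indicator_nonneg (fun x hx => hf0 x hx) x
  have hgint : ∫ x, g x = ∫ x in Ioi (0:ℝ), f x := integral_indicator measurableSet_Ioi
  have hpi : Integrable (fun t : Fin n → ℝ => ∏ i, g (t i)) :=
    Integrable.fintype_prod (f := fun _ => g) (fun _ => hgi)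
  rw [← hgint]
  refine le_trans ?_ (simplex_bound n g hgi hg0)
  have hm : MeasurableSet {t : Fin n → ℝ | StrictMono t ∧ ∀ i, (0:ℝ) < t i} := by
    refine (measSet_strictMono n).inter ?_
    have : {t : Fin n → ℝ | ∀ i, (0:ℝ) < t i} = ⋂ i, {t | 0 < t i} := by ext; simp
    change MeasurableSet {t : Fin n → ℝ | ∀ i, (0:ℝ) < t i}
    rw [this]
    exact MeasurableSet.iInter fun i => measurableSet_lt measurable_const (measurable_pi_apply i)
  refine le_trans (norm_integral_le_of_norm_le (g := fun t : Fin n → ℝ => ∏ i, g (t i)) hpi.integrableOn ?_) ?_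
  · refine (ae_restrict_mem hm).mono ?_
    rintro t ⟨h1, h2⟩
    rw [norm_prod]
    refine Finset.prod_le_prod (fun _ _ => norm_nonneg _) fun j _ => ?_
    have : g (t j) = f (t j) := indicator_of_mem (h2 j) f
    rw [this]
    apply hb
    · unfold prevNode; split_ifs
      · exact le_rfl
      · exact (h2 _).le
    · unfold prevNode; split_ifs with h
      · exact h2 j
      · apply h1; rw [Fin.lt_def]; simp; omega
  · exact setIntegral_mono_set hpi.integrableOn
      (Eventually.of_forall fun t => Finset.prod_nonneg fun i _ => hg0 _)
      (Eventually.of_forall fun t ht => ht.1)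

lemma jost_bounds (q : ℝ → ℂ) (k : ℂ) (A : ℝ)
    (h : ∀ n, ‖ysimp q n 0 k‖ ≤ A ^ n / n.factorial) :
    ‖jost q k - 1‖ ≤ Real.exp A - 1 ∧ ‖jost q k - 1 - ysimp q 1 0 k‖ ≤ Real.exp A - 1 - A := by
  have hs : HasSum (fun n : ℕ => A ^ n / n.factorial) (Real.exp A) := by
    rw [Real.exp_eq_exp_ℝ]
    exact NormedSpace.expSeries_div_hasSum_exp A
  have h1 : HasSum (fun n : ℕ => A ^ (n+1) / (n+1).factorial) (Real.exp A - 1) := by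
    simpa using (hasSum_nat_add_iff' 1).2 hs
  have h2 : HasSum (fun n : ℕ => A ^ (n+2) / (n+2).factorial) (Real.exp A - 1 - A) := by
    have := (hasSum_nat_add_iff' 2).2 hs
    simpa [Finset.sum_range_succ, sub_sub] using this
  have hsm : Summable (fun n : ℕ => ysimp q (n+1) 0 k) :=
    Summable.of_norm_bounded h1.summable (fun n => h (n+1))
  constructor
  · simp only [jost, add_sub_cancel_left]
    exact tsum_of_norm_bounded h1 (fun n => h (n+1))
  · simp only [jost, add_sub_cancel_left]
    rw [hsm.tsum_eq_zero_add]
    simp only [zero_add, add_sub_cancel_left]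
    exact tsum_of_norm_bounded h2 (fun n => h (n+2))

lemma norm_G_le_inv (t k : ℝ) (hk : k ≠ 0) : ‖G t k‖ ≤ 1 / |k| := by
  have hk' : (k:ℂ) ≠ 0 := by exact_mod_cast hk
  have he : ‖Complex.exp (Complex.I * k * t)‖ = 1 := by
    rw [show Complex.I * k * t = ((k * t : ℝ) : ℂ) * Complex.I by push_cast; ring]
    exact Complex.norm_exp_ofReal_mul_I _
  rw [G, if_neg hk', norm_mul, he, mul_one, norm_div, ← Complex.ofReal_mul, ← Complex.ofReal_sin,
    Complex.norm_real, Complex.norm_real, Real.norm_eq_abs, Real.norm_eq_abs]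
  gcongr
  exact Real.abs_sin_le_one _

lemma norm_G_le (t k : ℝ) : ‖G t k‖ ≤ |t| := by
  by_cases hk : k = 0
  · simp [G, hk]
  have hk' : (k:ℂ) ≠ 0 := by exact_mod_cast hk
  have he : ‖Complex.exp (Complex.I * k * t)‖ = 1 := by
    rw [show Complex.I * k * t = ((k * t : ℝ) : ℂ) * Complex.I by push_cast; ring]
    exact Complex.norm_exp_ofReal_mul_I _
  rw [G, if_neg hk', norm_mul, he, mul_one, norm_div, ← Complex.ofReal_mul, ← Complex.ofReal_sin,
    Complex.norm_real, Complex.norm_real, Real.norm_eq_abs, Real.norm_eq_abs,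
    div_le_iff₀ (abs_pos.2 hk), mul_comm, ← abs_mul]
  exact Real.abs_sin_le_abs

lemma ysimp_one (q : ℝ → ℂ) (k : ℂ) : ysimp q 1 0 k = ∫ x in Ioi (0:ℝ), G x k * q x := by
  have := (volume_preserving_funUnique (Fin 1) ℝ).setIntegral_preimage_emb
    (MeasurableEquiv.funUnique (Fin 1) ℝ).measurableEmbedding (fun x => G x k * q x) (Ioi 0)
  rw [← this, ysimp]
  have hset : {t : Fin 1 → ℝ | StrictMono t ∧ ∀ i, (0:ℝ) < t i} =
      (MeasurableEquiv.funUnique (Fin 1) ℝ) ⁻¹' Ioi 0 := by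
    ext t
    simp [MeasurableEquiv.funUnique, Subsingleton.strictMono]
  rw [hset]
  simp [prevNode, MeasurableEquiv.funUnique]
  rfl

lemma G_add (x t : ℝ) (ht : t ≠ 0) :
    G x t + G x (-t) = ((Real.sin (2 * t * x) / t : ℝ) : ℂ) := by
  have ht' : (t:ℂ) ≠ 0 := by exact_mod_cast ht
  rw [G, if_neg ht', G, if_neg (neg_ne_zero.2 ht')]
  have e1 : Complex.exp (Complex.I * t * x) = Complex.cos (t*x) + Complex.sin (t*x) * I := by
    rw [← Complex.exp_mul_I]; ring_nf
  have e2 : Complex.exp (Complex.I * -t * x) = Complex.cos (t*x) - Complex.sin (t*x) * I := by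
    rw [show Complex.I * -t * x = (-(t*x)) * I by ring, Complex.exp_mul_I]; simp; ring
  rw [e1, e2]
  push_cast
  rw [show (2:ℂ) * t * x = 2 * (t * x) by ring, Complex.sin_two_mul, neg_mul, Complex.sin_neg]
  field_simp
  ring

lemma log_bound1 (z : ℂ) (h : 1 + z ≠ 0) : Real.log ‖1 + z‖ ≤ z.re + ‖z‖ ^ 2 / 2 := by
  have h1 : Real.log (‖1 + z‖ ^ 2) ≤ ‖1 + z‖ ^ 2 - 1 :=
    Real.log_le_sub_one_of_pos (by positivity)
  rw [Real.log_pow] at h1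
  have h2 : ‖1 + z‖ ^ 2 = 1 + 2 * z.re + ‖z‖ ^ 2 := by
    rw [← Complex.normSq_eq_norm_sq, ← Complex.normSq_eq_norm_sq, Complex.normSq_apply,
      Complex.normSq_apply]
    simp; ring
  push_cast at h1
  linarith

lemma log_bound (z w : ℂ) :
    Real.log ‖(1 + z) * (1 + w)‖ ≤ z.re + w.re + 2 * ‖z‖ ^ 2 + 2 * ‖w‖ ^ 2 := by
  have key : ∀ z : ℂ, -(1/8) ≤ z.re + 2 * ‖z‖ ^ 2 := by
    intro z
    have := sq_abs z.re ▸ pow_le_pow_left₀ (abs_nonneg _) (Complex.abs_re_le_norm z) 2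
    nlinarith [sq_nonneg (4 * z.re + 1)]
  by_cases hz : 1 + z = 0
  · have : z = -1 := by linear_combination hz
    subst this
    have := key w
    simp; linarith
  by_cases hw : 1 + w = 0
  · have : w = -1 := by linear_combination hw
    subst this
    have := key z
    simp; linarith
  rw [norm_mul, Real.log_mul (by simpa using hz) (by simpa using hw)]
  nlinarith [log_bound1 z hz, log_bound1 w hw, sq_nonneg ‖z‖, sq_nonneg ‖w‖]

noncomputable def Sint (r : ℝ) : ℝ := ∫ t in (0:ℝ)..r, Real.sin t / t

lemma abs_sin_div_le (t : ℝ) : |Real.sin t / t| ≤ 1 := by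
  rw [abs_div]; exact div_le_one_of_le₀ Real.abs_sin_le_abs (abs_nonneg _)

lemma meas_sin_div : Measurable (fun t : ℝ => Real.sin t / t) :=
  Real.measurable_sin.div measurable_id

lemma ii_sin_div (a b : ℝ) : IntervalIntegrable (fun t : ℝ => Real.sin t / t) volume a b := by
  refine (intervalIntegrable_const (c := (1:ℝ))).mono_fun meas_sin_div.aestronglyMeasurable ?_
  exact Eventually.of_forall fun t => by
    change |Real.sin t / t| ≤ |(1:ℝ)|
    rw [abs_one]; exact abs_sin_div_le t

lemma intExpIoi (r : ℝ) (hr : 0 < r) : IntegrableOn (fun y => Real.exp (-(r * y))) (Ioi 0) ∧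
    ∫ y in Ioi (0:ℝ), Real.exp (-(r * y)) = 1 / r := by
  constructor
  · simpa using integrableOn_exp_mul_Ioi (a := -r) (by linarith) 0
  · have := integral_exp_mul_Ioi (a := -r) (by linarith) 0
    simpa using this

lemma inner_int (R y : ℝ) : ∫ r in (0:ℝ)..R, Real.sin r * Real.exp (-(r * y)) =
    (1 - Real.exp (-(R * y)) * (Real.cos R + y * Real.sin R)) / (1 + y ^ 2) := by
  have hy : 1 + y ^ 2 ≠ 0 := by positivity
  have hd : ∀ r ∈ uIcc 0 R, HasDerivAt
      (fun r => -(Real.exp (-(r * y)) * (Real.cos r + y * Real.sin r)) / (1 + y ^ 2))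
      (Real.sin r * Real.exp (-(r * y))) r := by
    intro r _
    have h1 : HasDerivAt (fun r : ℝ => Real.exp (-(r * y))) (Real.exp (-(r * y)) * (-(1 * y))) r :=
      ((hasDerivAt_id r).mul_const y).neg.exp
    have h2 := (Real.hasDerivAt_cos r).add ((Real.hasDerivAt_sin r).const_mul y)
    have h3 := ((h1.mul h2).neg).div_const (1 + y ^ 2)
    refine h3.congr_deriv ?_
    field_simp
    simp only [Pi.add_apply]
    ring
  rw [intervalIntegral.integral_eq_sub_of_hasDerivAt hd (by
    apply Continuous.intervalIntegrable; fun_prop)]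
  simp
  field_simp
  ring

lemma Sint_bound (R : ℝ) (hR : 0 < R) : |Sint R - Real.pi / 2| ≤ 2 / R := by
  have hint : Integrable (Function.uncurry fun r y : ℝ => Real.sin r * Real.exp (-(r * y)))
      ((volume.restrict (Ioc 0 R)).prod (volume.restrict (Ioi 0))) := by
    rw [integrable_prod_iff (by
      apply Continuous.aestronglyMeasurable; unfold Function.uncurry; fun_prop)]
    constructor
    · refine (ae_restrict_mem measurableSet_Ioc).mono fun r hr => ?_
      exact (intExpIoi r hr.1).1.const_mul (Real.sin r)
    · have h1 : IntegrableOn (fun r : ℝ => |Real.sin r / r|) (Ioc 0 R) := by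
        have := (ii_sin_div 0 R).abs
        rwa [intervalIntegrable_iff_integrableOn_Ioc_of_le hR.le] at this
      refine h1.congr_fun (fun r hr => ?_) measurableSet_Ioc
      simp only [Function.uncurry, norm_mul, Real.norm_eq_abs, Real.abs_exp]
      rw [integral_const_mul, (intExpIoi r hr.1).2, abs_div, abs_of_pos hr.1]
      ring
  have hswap := integral_integral_swap hint
  have hL : ∫ r in Ioc 0 R, ∫ y in Ioi (0:ℝ), Real.sin r * Real.exp (-(r * y)) = Sint R := by
    rw [Sint, intervalIntegral.integral_of_le hR.le]
    refine setIntegral_congr_fun measurableSet_Ioc fun r hr => ?_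
    rw [integral_const_mul, (intExpIoi r hr.1).2]
    ring
  have hRt : ∀ y : ℝ, ∫ r in Ioc 0 R, Real.sin r * Real.exp (-(r * y)) =
      (1 - Real.exp (-(R * y)) * (Real.cos R + y * Real.sin R)) / (1 + y ^ 2) := by
    intro y
    rw [← intervalIntegral.integral_of_le hR.le, inner_int]
  have hi2 := hint.integral_prod_right
  simp only [Function.uncurry] at hi2
  rw [hL] at hswap
  simp only [hRt] at hswap hi2
  have hpi : ∫ y in Ioi (0:ℝ), (1 + y ^ 2)⁻¹ = Real.pi / 2 := by
    simp [integral_Ioi_inv_one_add_sq]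
  rw [hswap, ← hpi, ← integral_sub hi2 integrable_inv_one_add_sq.integrableOn]
  have hE := intExpIoi R hR
  have hb : ‖∫ y in Ioi (0:ℝ), ((1 - Real.exp (-(R * y)) * (Real.cos R + y * Real.sin R)) / (1 + y ^ 2)
      - (1 + y ^ 2)⁻¹)‖ ≤ ∫ y in Ioi (0:ℝ), 2 * Real.exp (-(R * y)) := by
    refine norm_integral_le_of_norm_le (hE.1.const_mul 2) ?_
    refine (ae_restrict_mem measurableSet_Ioi).mono fun y hy => ?_
    have hy : 0 < y := hy
    have h1 : (1 - Real.exp (-(R * y)) * (Real.cos R + y * Real.sin R)) / (1 + y ^ 2)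
      - (1 + y ^ 2)⁻¹ = -(Real.exp (-(R * y)) * ((Real.cos R + y * Real.sin R) / (1 + y ^ 2))) := by
      field_simp; ring
    rw [h1, norm_neg, norm_mul, Real.norm_eq_abs, Real.norm_eq_abs, Real.abs_exp, mul_comm]
    gcongr
    rw [abs_div, abs_of_pos (show 0 < 1 + y ^ 2 by positivity), div_le_iff₀ (by positivity)]
    have h2 := abs_add_le (Real.cos R) (y * Real.sin R)
    rw [abs_mul, abs_of_pos hy] at h2
    nlinarith [Real.abs_cos_le_one R, Real.abs_sin_le_one R, sq_nonneg (y - 1)]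
  rw [integral_const_mul, hE.2] at hb
  rw [Real.norm_eq_abs] at hb
  convert hb using 1; ring

lemma Sint_bound' (R : ℝ) (hR : 0 ≤ R) : |Sint R - Real.pi / 2| ≤ 3 := by
  rcases le_or_gt R 1 with h | h
  · have h1 : |Sint R| ≤ 1 := by
      have := intervalIntegral.norm_integral_le_of_norm_le_const (a := 0) (b := R) (C := 1)
        (f := fun t : ℝ => Real.sin t / t) (fun t _ => abs_sin_div_le t)
      rw [Real.norm_eq_abs] at this
      refine this.trans ?_
      rw [sub_zero, abs_of_nonneg hR]; linarith
    rw [abs_le] at h1 ⊢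
    constructor <;> linarith [Real.pi_pos, Real.pi_lt_d2]
  · refine (Sint_bound R (by linarith)).trans ?_
    rw [div_le_iff₀ (by linarith)]; linarith

lemma Sint_tendsto : Tendsto Sint atTop (nhds (Real.pi / 2)) := by
  rw [tendsto_iff_norm_sub_tendsto_zero]
  refine squeeze_zero' (Eventually.of_forall fun _ => norm_nonneg _) ?_
    (tendsto_const_nhds.div_atTop tendsto_id : Tendsto (fun R : ℝ => (2:ℝ) / id R) atTop (nhds 0))
  filter_upwards [eventually_gt_atTop 0] with R hR using Sint_bound R hR

lemma Sint_continuous : Continuous Sint :=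
  intervalIntegral.continuous_primitive ii_sin_div 0

lemma sin_int (x a b : ℝ) (hx : x ≠ 0) :
    ∫ t in a..b, Real.sin (2 * t * x) / t = Sint (2 * b * x) - Sint (2 * a * x) := by
  have h := intervalIntegral.mul_integral_comp_mul_left (a := a) (b := b)
    (f := fun t => Real.sin t / t) (c := 2 * x)
  rw [Sint, Sint, intervalIntegral.integral_interval_sub_left (ii_sin_div _ _) (ii_sin_div _ _)]
  rw [show 2 * b * x = 2 * x * b by ring, show 2 * a * x = 2 * x * a by ring, ← h,
    ← intervalIntegral.integral_const_mul]
  congr 1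
  ext t
  by_cases ht : t = 0
  · simp [ht]
  field_simp

lemma fubini_D (q : ℝ → ℂ) (hqi : IntegrableOn q (Ioi 0)) (Q s : ℝ)
    (hQ : 1 ≤ Q) (hs : Q ≤ s) :
    IntervalIntegrable (fun t : ℝ => ∫ x in Ioi (0:ℝ), (q x).re * (Real.sin (2 * t * x) / t)) volume Q s ∧
    ∫ t in Q..s, ∫ x in Ioi (0:ℝ), (q x).re * (Real.sin (2 * t * x) / t) =
      ∫ x in Ioi (0:ℝ), (q x).re * (Sint (2 * s * x) - Sint (2 * Q * x)) := by
  have hre : IntegrableOn (fun x => (q x).re) (Ioi 0) := hqi.re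
  have hint : Integrable (Function.uncurry fun t x : ℝ => (q x).re * (Real.sin (2 * t * x) / t))
      ((volume.restrict (Ioc Q s)).prod (volume.restrict (Ioi 0))) := by
    have h1 : Integrable (fun _ : ℝ => (1:ℝ)) (volume.restrict (Ioc Q s)) :=
      integrable_const _
    have h2 := h1.mul_prod hre
    refine h2.mono ?_ ?_
    · have hq' : AEStronglyMeasurable (fun p : ℝ × ℝ => (q p.2).re)
        ((volume.restrict (Ioc Q s)).prod (volume.restrict (Ioi 0))) :=
        hre.aestronglyMeasurable.comp_snd
      refine hq'.mul (Measurable.aestronglyMeasurable ?_)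
      have : Measurable (fun p : ℝ × ℝ => 2 * p.1 * p.2) := by fun_prop
      exact (Real.measurable_sin.comp this).div measurable_fst
    · have hmem : ∀ᵐ p ∂((volume.restrict (Ioc Q s)).prod (volume.restrict (Ioi (0:ℝ)))),
          p ∈ Ioc Q s ×ˢ Ioi (0:ℝ) := by
        rw [Measure.prod_restrict]
        exact ae_restrict_mem (measurableSet_Ioc.prod measurableSet_Ioi)
      refine hmem.mono ?_
      rintro ⟨t, x⟩ ⟨ht, hx⟩
      simp only [Function.uncurry, norm_mul, one_mul, norm_one]
      have ht1 : 1 ≤ t := hQ.trans ht.1.le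
      have : ‖Real.sin (2 * t * x) / t‖ ≤ 1 := by
        rw [Real.norm_eq_abs, abs_div, abs_of_pos (by linarith : (0:ℝ) < t)]
        exact div_le_one_of_le₀ ((Real.abs_sin_le_one _).trans ht1) (by linarith)
      exact mul_le_of_le_one_right (norm_nonneg _) this
  refine ⟨?_, ?_⟩
  · rw [intervalIntegrable_iff_integrableOn_Ioc_of_le hs]
    exact hint.integral_prod_left
  · rw [intervalIntegral.integral_of_le hs, integral_integral_swap hint]
    refine setIntegral_congr_fun measurableSet_Ioi fun x hx => ?_
    have hx : 0 < x := hx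
    change ∫ t in Ioc Q s, (q x).re * (Real.sin (2 * t * x) / t) = _
    rw [integral_const_mul, ← intervalIntegral.integral_of_le hs, sin_int x Q s hx.ne']

lemma tendsto_D (q : ℝ → ℂ) (hqi : IntegrableOn q (Ioi 0)) (Q : ℝ) (hQ : 1 ≤ Q) :
    Tendsto (fun s : ℝ => ∫ x in Ioi (0:ℝ), (q x).re * (Sint (2 * s * x) - Sint (2 * Q * x)))
      atTop (nhds (∫ x in Ioi (0:ℝ), (q x).re * (Real.pi / 2 - Sint (2 * Q * x)))) := by
  have hre : IntegrableOn (fun x => (q x).re) (Ioi 0) := hqi.re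
  have hc : ∀ s : ℝ, Continuous fun x : ℝ => Sint (2 * s * x) := fun s =>
    Sint_continuous.comp (by fun_prop)
  refine tendsto_integral_filter_of_dominated_convergence (fun x => ‖(q x).re‖ * 6) ?_ ?_
    (hre.norm.mul_const 6) ?_
  · exact Eventually.of_forall fun s =>
      hre.aestronglyMeasurable.mul ((hc s).sub (hc Q)).aestronglyMeasurable
  · filter_upwards [eventually_ge_atTop 0] with s hs
    refine (ae_restrict_mem measurableSet_Ioi).mono fun x hx => ?_
    have hx : 0 < x := hx
    rw [norm_mul]
    gcongr
    have h1 := abs_le.1 (Sint_bound' (2 * s * x) (by positivity))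
    have h2 := abs_le.1 (Sint_bound' (2 * Q * x) (by positivity))
    rw [Real.norm_eq_abs, abs_le]
    constructor <;> linarith [h1.1, h1.2, h2.1, h2.2]
  · refine (ae_restrict_mem measurableSet_Ioi).mono fun x hx => ?_
    have hx : 0 < x := hx
    refine Tendsto.const_mul _ (Tendsto.sub_const (Sint_tendsto.comp ?_) _)
    have : Tendsto (fun s : ℝ => s * (2 * x)) atTop atTop :=
      tendsto_id.atTop_mul_const (by positivity)
    exact this.congr fun s => by ring

/-- If `q` is measurable with `∫_0^∞ (1+x)|q(x)| dx < ∞` and `‖q‖ ≥ 1`, then with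
`C₀ = (4e² + 1 + e⁴)/4`,
`limsup_{s→∞} (1/π)∫_0^s log|ψ(t)ψ(−t)| dt
  ≤ (2/π)(‖q‖₁ + ‖q‖(C₀ + log ‖q‖)) + (1/2)∫_0^∞ Re q(x)·(1 − φ(2x‖q‖)) dx`. -/
theorem jost_log_integral_bound (q : ℝ → ℂ) (hmq : Measurable q)
    (hq : IntegrableOn (fun x => (1 + x) * ‖q x‖) (Set.Ioi 0))
    (hq1 : 1 ≤ ∫ x in Set.Ioi (0:ℝ), ‖q x‖) :
    limsup (fun s : ℝ => (1 / Real.pi) * ∫ t in (0:ℝ)..s,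
        Real.log ‖jost q t * jost q (-t)‖) atTop ≤
      (2 / Real.pi) * ((∫ x in Set.Ioi (0:ℝ), x * ‖q x‖) +
          (∫ x in Set.Ioi (0:ℝ), ‖q x‖) *
            ((4 * Real.exp 2 + 1 + Real.exp 4) / 4 +
              Real.log (∫ x in Set.Ioi (0:ℝ), ‖q x‖))) +
        (1 / 2) * ∫ x in Set.Ioi (0:ℝ),
          (q x).re * (1 - phiSine (2 * x * ∫ y in Set.Ioi (0:ℝ), ‖q y‖)) := by
  have hpi := Real.pi_pos
  -- integrability
  have hqn : IntegrableOn (fun x => ‖q x‖) (Ioi 0) := by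
    refine Integrable.mono hq hmq.norm.aestronglyMeasurable ?_
    refine (ae_restrict_mem measurableSet_Ioi).mono fun x hx => ?_
    have hx : 0 < x := hx
    rw [norm_norm, norm_mul, norm_norm, Real.norm_eq_abs, abs_of_pos (by linarith)]
    nlinarith [norm_nonneg (q x)]
  have hqi : IntegrableOn q (Ioi 0) :=
    (integrable_norm_iff hmq.aestronglyMeasurable).1 hqn
  have hq1i : IntegrableOn (fun x => x * ‖q x‖) (Ioi 0) := by
    refine (hq.sub hqn).congr_fun (fun x _ => ?_) measurableSet_Ioi
    simp only [Pi.sub_apply]; ring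
  have hre : IntegrableOn (fun x => (q x).re) (Ioi 0) := hqi.re
  set Q := ∫ x in Ioi (0:ℝ), ‖q x‖ with hQdef
  set N := ∫ x in Ioi (0:ℝ), x * ‖q x‖ with hNdef
  have hN0 : 0 ≤ N := setIntegral_nonneg measurableSet_Ioi fun x hx =>
    mul_nonneg (le_of_lt hx) (norm_nonneg _)
  set C : ℝ := (4 * Real.exp 2 + 1 + Real.exp 4) / 4 with hC
  have hC9 : 9 ≤ C := by
    have h1 := Real.exp_one_gt_d9
    have h2 : Real.exp 2 = Real.exp 1 ^ 2 := by rw [← Real.exp_nat_mul]; norm_num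
    have h4 : Real.exp 4 = Real.exp 2 ^ 2 := by rw [← Real.exp_nat_mul]; norm_num
    have h5 : 7 ≤ Real.exp 2 := by rw [h2]; nlinarith
    rw [hC, h4]; nlinarith
  have hlogQ : 0 ≤ Real.log Q := Real.log_nonneg hq1
  set J := ∫ x in Ioi (0:ℝ), (q x).re * (Real.pi / 2 - Sint (2 * Q * x)) with hJ
  have hphi : ∫ x in Ioi (0:ℝ), (q x).re * (1 - phiSine (2 * x * Q)) = (2 / Real.pi) * J := by
    rw [hJ, ← integral_const_mul]
    congr 1
    ext x
    rw [phiSine, show 2 * x * Q = 2 * Q * x by ring, Sint]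
    field_simp
  rw [hphi]
  have hJb : |J| ≤ Q * 3 := by
    rw [hQdef, ← integral_mul_const]
    refine norm_integral_le_of_norm_le (f := fun x => (q x).re * (Real.pi / 2 - Sint (2 * Q * x)))
      (hqn.mul_const 3) ?_
    refine (ae_restrict_mem measurableSet_Ioi).mono fun x hx => ?_
    have hx : 0 < x := hx
    rw [norm_mul]
    have h1 := Sint_bound' (2 * Q * x) (by positivity)
    rw [abs_sub_comm] at h1
    exact mul_le_mul (Complex.abs_re_le_norm _) h1 (norm_nonneg _) (norm_nonneg _)
  -- bounds on jost
  have hcast : ∀ t : ℝ, (-(t:ℂ)) = ((-t : ℝ) : ℂ) := fun t => by push_cast; rfl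
  have hyN : ∀ t : ℝ, ∀ n, ‖ysimp q n 0 t‖ ≤ N ^ n / n.factorial := fun t =>
    ysimp_bound q t _ hq1i (fun a b ha hab => by
      rw [norm_mul]
      refine mul_le_mul_of_nonneg_right ((norm_G_le _ _).trans ?_) (norm_nonneg _)
      rw [abs_of_pos (by linarith)]; linarith)
  have hyQ : ∀ t : ℝ, t ≠ 0 → ∀ n, ‖ysimp q n 0 t‖ ≤ (Q / |t|) ^ n / n.factorial := by
    intro t ht n
    have := ysimp_bound q t _ (hqn.const_mul (1 / |t|)) (fun a b ha hab => by
      rw [norm_mul]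
      exact mul_le_mul_of_nonneg_right (norm_G_le_inv _ _ ht) (norm_nonneg _)) n
    rwa [integral_const_mul, ← hQdef, one_div_mul_eq_div] at this
  have hjA : ∀ k : ℂ, ∀ A : ℝ, (∀ n, ‖ysimp q n 0 k‖ ≤ A ^ n / n.factorial) →
      ‖jost q k‖ ≤ Real.exp A := by
    intro k A h
    have h1 := (jost_bounds q k A h).1
    have h2 := norm_add_le (jost q k - 1) 1
    rw [sub_add_cancel, norm_one] at h2
    linarith
  have hlogA : ∀ a b : ℂ, ∀ A : ℝ, 0 ≤ A → ‖a‖ ≤ Real.exp A → ‖b‖ ≤ Real.exp A →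
      Real.log ‖a * b‖ ≤ 2 * A := by
    intro a b A hA ha hb
    by_cases h : a * b = 0
    · rw [h]; simpa using hA
    rw [Real.log_le_iff_le_exp (norm_pos_iff.2 h), norm_mul, two_mul, Real.exp_add]
    exact mul_le_mul ha hb (norm_nonneg _) (Real.exp_pos _).le
  set L : ℝ → ℝ := fun t => Real.log ‖jost q t * jost q (-t)‖ with hL
  have hLN : ∀ t, L t ≤ 2 * N := by
    intro t
    refine hlogA _ _ N hN0 (hjA _ _ (hyN t)) ?_
    rw [hcast]; exact hjA _ _ (hyN (-t))
  have hLQ : ∀ t, 0 < t → L t ≤ 2 * (Q / t) := by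
    intro t ht
    have h1 := hyQ t ht.ne'
    have h2 := hyQ (-t) (by linarith)
    rw [abs_neg] at h2
    rw [abs_of_pos ht] at h1 h2
    refine hlogA _ _ (Q / t) (by positivity) (hjA _ _ h1) ?_
    rw [hcast]; exact hjA _ _ h2
  have hy1 : ∀ t : ℝ, t ≠ 0 → (ysimp q 1 0 t).re + (ysimp q 1 0 ((-t : ℝ) : ℂ)).re =
      ∫ x in Ioi (0:ℝ), (q x).re * (Real.sin (2 * t * x) / t) := by
    intro t ht
    have hGi : ∀ k : ℝ, k ≠ 0 → IntegrableOn (fun x => G x k * q x) (Ioi 0) := by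
      intro k hk
      refine Integrable.bdd_mul (c := 1 / |k|) hqi ?_ (Eventually.of_forall fun x => norm_G_le_inv x k hk)
      have hk' : (k:ℂ) ≠ 0 := by exact_mod_cast hk
      simp only [G, if_neg hk']
      apply Continuous.aestronglyMeasurable
      fun_prop
    rw [← Complex.add_re, ysimp_one, ysimp_one, ← integral_add (hGi t ht) (hGi (-t) (by simpa using ht))]
    have : ∀ x : ℝ, G x t * q x + G x ((-t : ℝ) : ℂ) * q x = ((Real.sin (2 * t * x) / t : ℝ) : ℂ) * q x := by
      intro x; rw [← G_add x t ht]; push_cast; ring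
    simp only [this]
    have hii : IntegrableOn (fun x => ((Real.sin (2 * t * x) / t : ℝ) : ℂ) * q x) (Ioi 0) := by
      refine IntegrableOn.congr_fun ((hGi t ht).add (hGi (-t) (by simpa using ht)))
        (fun x _ => this x) measurableSet_Ioi
    have h3 := integral_re (𝕜 := ℂ) hii
    refine h3.symm.trans ?_
    congr 1
    ext x
    change ((((Real.sin (2 * t * x) / t : ℝ) : ℂ)) * q x).re = _
    rw [Complex.re_ofReal_mul, mul_comm]
  have hLbig : ∀ t, Q ≤ t → L t ≤
      (∫ x in Ioi (0:ℝ), (q x).re * (Real.sin (2 * t * x) / t)) + 2 * C * Q ^ 2 * (1 / t ^ 2) := by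
    intro t htQ
    have ht : 0 < t := by linarith
    have hu0 : 0 ≤ Q / t := by positivity
    have hu1 : Q / t ≤ 1 := div_le_one_of_le₀ htQ ht.le
    have e1 := (abs_le.1 (Real.abs_exp_sub_one_sub_id_le (abs_le.2 ⟨by linarith, hu1⟩))).2
    have e2 := (abs_le.1 (Real.abs_exp_sub_one_le (abs_le.2 ⟨by linarith, hu1⟩))).2
    rw [abs_of_nonneg hu0] at e2
    have gen : ∀ k : ℂ, (∀ n, ‖ysimp q n 0 k‖ ≤ (Q / t) ^ n / n.factorial) →
        (jost q k - 1).re + 2 * ‖jost q k - 1‖ ^ 2 ≤ (ysimp q 1 0 k).re + 9 * (Q / t) ^ 2 := by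
      intro k hk
      obtain ⟨b1, b2⟩ := jost_bounds q k _ hk
      have b3 := (le_abs_self _).trans (Complex.abs_re_le_norm (jost q k - 1 - ysimp q 1 0 k))
      rw [Complex.sub_re] at b3
      have b4 : ‖jost q k - 1‖ ^ 2 ≤ (2 * (Q / t)) ^ 2 :=
        pow_le_pow_left₀ (norm_nonneg _) (by linarith) 2
      nlinarith
    have h1 := hyQ t ht.ne'
    have h2 := hyQ (-t) (by linarith)
    rw [abs_neg] at h2
    rw [abs_of_pos ht] at h1 h2
    have g1 := gen _ h1
    have g2 := gen _ h2
    have lb := log_bound (jost q t - 1) (jost q ((-t : ℝ) : ℂ) - 1)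
    rw [add_sub_cancel, add_sub_cancel, ← hcast] at lb
    rw [← hcast] at g2
    have hy := hy1 t ht.ne'
    rw [← hcast] at hy
    have h9 : 18 * (Q / t) ^ 2 ≤ 2 * C * Q ^ 2 * (1 / t ^ 2) := by
      rw [show 2 * C * Q ^ 2 * (1 / t ^ 2) = 2 * C * (Q / t) ^ 2 by field_simp]
      nlinarith [sq_nonneg (Q / t)]
    simp only [hL]
    linarith
  set D : ℝ → ℝ := fun s => ∫ x in Ioi (0:ℝ), (q x).re * (Sint (2 * s * x) - Sint (2 * Q * x)) with hD
  have hDt : Tendsto D atTop (nhds J) := tendsto_D q hqi Q hq1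
  set B : ℝ → ℝ := fun s => (1 / Real.pi) * (2 * N + 2 * Q * Real.log Q + D s + 2 * C * Q) with hB
  set RHS := 2 / Real.pi * (N + Q * (C + Real.log Q)) + 1 / 2 * (2 / Real.pi * J) with hR
  have hBt : Tendsto B atTop (nhds RHS) := by
    have : RHS = (1 / Real.pi) * (2 * N + 2 * Q * Real.log Q + J + 2 * C * Q) := by
      rw [hR]; field_simp; ring
    rw [this]
    exact ((hDt.const_add _).add_const _).const_mul _
  have hR0 : 0 ≤ RHS := by
    have : RHS = (1 / Real.pi) * (2 * N + 2 * Q * Real.log Q + J + 2 * C * Q) := by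
      rw [hR]; field_simp; ring
    rw [this]
    have h1 := (abs_le.1 hJb).1
    have h2 : 0 ≤ Q * Real.log Q := by positivity
    have h3 : 0 ≤ 2 * N + 2 * Q * Real.log Q + J + 2 * C * Q := by nlinarith
    positivity
  have hbound : ∀ s, Q ≤ s → (1 / Real.pi) * ∫ t in (0:ℝ)..s, L t ≤ max 0 (B s) := by
    intro s hs
    by_cases hi : IntervalIntegrable L volume 0 s
    swap
    · rw [intervalIntegral.integral_undef hi]; simp
    refine le_max_of_le_right ?_
    simp only [hB]
    gcongr
    have hi1 : IntervalIntegrable L volume 0 1 := hi.mono_set (by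
      rw [uIcc_of_le (by linarith), uIcc_of_le (by linarith)]; exact Icc_subset_Icc le_rfl (by linarith))
    have hi2 : IntervalIntegrable L volume 1 Q := hi.mono_set (by
      rw [uIcc_of_le (by linarith), uIcc_of_le (by linarith)]; exact Icc_subset_Icc (by linarith) (by linarith))
    have hi3 : IntervalIntegrable L volume Q s := hi.mono_set (by
      rw [uIcc_of_le (by linarith), uIcc_of_le (by linarith)]; exact Icc_subset_Icc (by linarith) (by linarith))
    rw [← intervalIntegral.integral_add_adjacent_intervals (hi1.trans hi2) hi3,
      ← intervalIntegral.integral_add_adjacent_intervals hi1 hi2]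
    have p1 : ∫ t in (0:ℝ)..1, L t ≤ 2 * N := by
      refine (intervalIntegral.integral_mono_on (by norm_num) hi1
        (intervalIntegrable_const (c := 2 * N)) (fun t _ => hLN t)).trans ?_
      simp
    have p2 : ∫ t in (1:ℝ)..Q, L t ≤ 2 * Q * Real.log Q := by
      have hc : IntervalIntegrable (fun t : ℝ => 2 * Q * (1 / t)) volume 1 Q := by
        refine (intervalIntegral.intervalIntegrable_one_div (fun t ht => ?_) continuousOn_id).const_mul _
        rw [uIcc_of_le hq1] at ht
        exact (by linarith [ht.1] : (0:ℝ) < t).ne'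
      refine (intervalIntegral.integral_mono_on hq1 hi2 hc (fun t ht => ?_)).trans ?_
      · have := hLQ t (by linarith [ht.1])
        rwa [show 2 * Q * (1 / t) = 2 * (Q / t) by ring]
      · rw [intervalIntegral.integral_const_mul, integral_one_div_of_pos one_pos (by linarith), div_one]
    have p3 : ∫ t in Q..s, L t ≤ D s + 2 * C * Q := by
      obtain ⟨f1, f2⟩ := fubini_D q hqi Q s hq1 hs
      have hd : ∀ t ∈ uIcc Q s, HasDerivAt (fun t : ℝ => -t⁻¹) (1 / t ^ 2) t := by
        intro t ht
        rw [uIcc_of_le hs] at ht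
        have := (hasDerivAt_inv (by linarith [ht.1] : (0:ℝ) < t).ne').neg
        refine this.congr_deriv ?_
        ring
      have hc0 : IntervalIntegrable (fun t : ℝ => 1 / t ^ 2) volume Q s := by
        apply ContinuousOn.intervalIntegrable
        intro t ht
        rw [uIcc_of_le hs] at ht
        have : t ≠ 0 := (by linarith [ht.1] : (0:ℝ) < t).ne'
        exact (continuousAt_const.div (continuousAt_id.pow 2) (pow_ne_zero 2 this)).continuousWithinAt
      have hc := hc0.const_mul (2 * C * Q ^ 2)
      refine (intervalIntegral.integral_mono_on hs hi3 (f1.add hc) (fun t ht => hLbig t ht.1)).trans ?_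
      rw [intervalIntegral.integral_add f1 hc, f2, intervalIntegral.integral_const_mul,
        intervalIntegral.integral_eq_sub_of_hasDerivAt hd hc0]
      have hs0 : 0 ≤ s⁻¹ := inv_nonneg.2 (by linarith)
      have : 2 * C * Q ^ 2 * (-s⁻¹ - -Q⁻¹) = 2 * C * Q - 2 * C * Q ^ 2 * s⁻¹ := by
        field_simp; ring
      rw [this]
      have : 0 ≤ 2 * C * Q ^ 2 * s⁻¹ := by positivity
      simp only [hD]
      linarith
    linarith
  -- conclusion
  have hmt : Tendsto (fun s => max 0 (B s)) atTop (nhds RHS) := by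
    have := (tendsto_const_nhds (x := (0:ℝ))).max hBt
    rwa [max_eq_right hR0] at this
  rw [limsup_eq]
  by_cases hbd : BddBelow {a | ∀ᶠ s in atTop, (1 / Real.pi) * ∫ t in (0:ℝ)..s, L t ≤ a}
  · refine le_of_forall_pos_le_add fun ε hε => csInf_le hbd ?_
    have h1 := hmt.eventually (eventually_lt_nhds (show RHS < RHS + ε by linarith))
    filter_upwards [h1, eventually_ge_atTop Q] with s h2 h3
    exact (hbound s h3).trans h2.le
  · rw [Real.sInf_of_not_bddBelow hbd]; exact hR0
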